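/- Suppose m distinct points x_1,…,x_m ∈ ℝ^s and Y = [y_j^k] ∈ ℝ^{t×m} are given, and the functions K_k(x_j,·), j ∈ {1,…,m}, k ∈ {1,…,t}, are linearly independent in C₀(Θ). Then the MNI problem inf{‖f_μ‖_{B_N} : f_μ ∈ B_N, f_μ(x_j) = y_j for all j ∈ {1,…,m}} has at least one solution; that is, there exists f̂ ∈ B_N with f̂(x_j) = y_j for all j, and ‖f̂‖_{B_N} ≤ ‖f_μ‖_{B_N} for every f_μ ∈ B_N satisfying f_μ(x_j) = y_j for all j. -/

import Mathlib

open MeasureTheory Filter Topology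
open scoped ZeroAtInfty BigOperators

noncomputable section

/-- The parameter space of a depth-`D` deep neural network with layer widths
`m 0, m 1, …, m D` (input dimension `m 0 = s`, output dimension `m D = t`). -/
abbrev Params (m : ℕ → ℕ) (D : ℕ) : Type :=
  (j : Fin D) → ((Fin (m (j.1 + 1)) → Fin (m j.1) → ℝ) × (Fin (m (j.1 + 1)) → ℝ))

/-- The deep neural network `N(x, θ)` of depth `D`, defined recursively by
`N¹(x) = W₁ x + b₁` and `N^{j+1}(x) = W_{j+1} σ(N^j(x)) + b_{j+1}`. -/
def NNet (σ : ℝ → ℝ) (m : ℕ → ℕ) :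
    (D : ℕ) → Params m D → (Fin (m 0) → ℝ) → Fin (m D) → ℝ
  | 0, _, x => x
  | 1, θ, x => fun i => (∑ k, (θ ⟨0, Nat.one_pos⟩).1 i k * x k) + (θ ⟨0, Nat.one_pos⟩).2 i
  | (D + 2), θ, x => fun i =>
      (∑ k, (θ (Fin.last (D + 1))).1 i k *
          σ (NNet σ m (D + 1) (fun j => θ j.castSucc) x k))
        + (θ (Fin.last (D + 1))).2 i

/-- The integral of a function against a finite signed (Radon) measure,
via the Jordan decomposition. -/
def sInt {Θ : Type*} [MeasurableSpace Θ] (μ : SignedMeasure Θ) (f : Θ → ℝ) : ℝ :=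
  (∫ θ, f θ ∂μ.toJordanDecomposition.posPart) - ∫ θ, f θ ∂μ.toJordanDecomposition.negPart

/-- The total variation norm of a signed measure. -/
def tvNorm {Θ : Type*} [MeasurableSpace Θ] (μ : SignedMeasure Θ) : ℝ :=
  (μ.totalVariation Set.univ).toReal

/-- `f_μ^k(x) := ∫_Θ N_k(x,θ) ρ(θ) dμ(θ)`. -/
def fMu (σ : ℝ → ℝ) (m : ℕ → ℕ) (D : ℕ) (ρ : Params m D → ℝ)
    (μ : SignedMeasure (Params m D)) : (Fin (m 0) → ℝ) → Fin (m D) → ℝ :=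
  fun x k => sInt μ fun θ => NNet σ m D θ x k * ρ θ

/-- The set `B_N = {f_μ : μ ∈ M(Θ)}`. -/
def BNset (σ : ℝ → ℝ) (m : ℕ → ℕ) (D : ℕ) (ρ : Params m D → ℝ) :
    Set ((Fin (m 0) → ℝ) → Fin (m D) → ℝ) :=
  {f | ∃ μ : SignedMeasure (Params m D), fMu σ m D ρ μ = f}

/-- The norm `‖f‖_{B_N} = inf {‖ν‖_TV : f_ν = f}`. -/
def BNnorm (σ : ℝ → ℝ) (m : ℕ → ℕ) (D : ℕ) (ρ : Params m D → ℝ)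
    (f : (Fin (m 0) → ℝ) → Fin (m D) → ℝ) : ℝ :=
  sInf (tvNorm '' {ν : SignedMeasure (Params m D) | fMu σ m D ρ ν = f})

/-- `S`: the closed linear span in `C₀(Θ)` of the functions `θ ↦ N_k(x,θ)ρ(θ)`
(given here as the bundled family `Kb`). -/
def Sspan (m : ℕ → ℕ) (D : ℕ)
    (Kb : (Fin (m 0) → ℝ) → Fin (m D) → C₀(Params m D, ℝ)) :
    Submodule ℝ C₀(Params m D, ℝ) :=
  (Submodule.span ℝ
    (Set.range fun p : (Fin (m 0) → ℝ) × Fin (m D) => Kb p.1 p.2)).topologicalClosure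

/-- `V_N := span {K_k(x_j, ·) : j, k}`. -/
def VN (m : ℕ → ℕ) (D : ℕ)
    (Kb : (Fin (m 0) → ℝ) → Fin (m D) → C₀(Params m D, ℝ))
    (M : ℕ) (x : Fin M → (Fin (m 0) → ℝ)) : Submodule ℝ C₀(Params m D, ℝ) :=
  Submodule.span ℝ (Set.range fun p : Fin (m D) × Fin M => Kb (x p.2) p.1)

/-- The interpolation condition `f(x_j) = y_j`, i.e. `f_k(x_j) = y_j^k` for all `j, k`. -/
def interpolates (m : ℕ → ℕ) (D : ℕ) (M : ℕ) (x : Fin M → (Fin (m 0) → ℝ))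
    (Y : Fin (m D) → Fin M → ℝ) (f : (Fin (m 0) → ℝ) → Fin (m D) → ℝ) : Prop :=
  ∀ (j : Fin M) (k : Fin (m D)), f (x j) k = Y k j

/-- The solution set `S_{X,Y}` of the MNI problem
`inf {‖f‖_{B_N} : f ∈ B_N, f(x_j) = y_j}`. -/
def MNISolSet (σ : ℝ → ℝ) (m : ℕ → ℕ) (D : ℕ) (ρ : Params m D → ℝ)
    (M : ℕ) (x : Fin M → (Fin (m 0) → ℝ)) (Y : Fin (m D) → Fin M → ℝ) :
    Set ((Fin (m 0) → ℝ) → Fin (m D) → ℝ) :=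
  {f | f ∈ BNset σ m D ρ ∧ interpolates m D M x Y f ∧
    ∀ μ : SignedMeasure (Params m D), interpolates m D M x Y (fMu σ m D ρ μ) →
      BNnorm σ m D ρ f ≤ BNnorm σ m D ρ (fMu σ m D ρ μ)}

/-- The solution set of the measure MNI problem
`inf {‖μ‖_TV : μ ∈ M(Θ), ∫ K_k(x_j,·) dμ = y_j^k}`. -/
def MeasSolSet (σ : ℝ → ℝ) (m : ℕ → ℕ) (D : ℕ) (ρ : Params m D → ℝ)
    (M : ℕ) (x : Fin M → (Fin (m 0) → ℝ)) (Y : Fin (m D) → Fin M → ℝ) :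
    Set (SignedMeasure (Params m D)) :=
  {μ | interpolates m D M x Y (fMu σ m D ρ μ) ∧
    ∀ ν : SignedMeasure (Params m D), interpolates m D M x Y (fMu σ m D ρ ν) →
      tvNorm μ ≤ tvNorm ν}

/-- The subdifferential `∂‖·‖_∞(g) ⊆ B_N` of the supremum norm at `g ∈ S`, viewing `B_N`
as the dual of `S` via the (representation independent) pairing `⟨f_μ, g⟩ = ∫ g dμ`:
`∂‖·‖_∞(g) = {f_μ ∈ B_N : ‖f_μ‖_{B_N} = 1, ∫ g dμ = ‖g‖_∞}`. -/
def subdiffSup (σ : ℝ → ℝ) (m : ℕ → ℕ) (D : ℕ) (ρ : Params m D → ℝ)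
    (g : C₀(Params m D, ℝ)) : Set ((Fin (m 0) → ℝ) → Fin (m D) → ℝ) :=
  {f | f ∈ BNset σ m D ρ ∧ BNnorm σ m D ρ f = 1 ∧
    ∀ μ : SignedMeasure (Params m D), fMu σ m D ρ μ = f → sInt μ (fun θ => g θ) = ‖g‖}

/-- Feasibility for the dual problem: `‖∑_{k,j} c_{kj} K_k(x_j,·)‖_∞ = 1`. -/
def dualFeasible (m : ℕ → ℕ) (D : ℕ)
    (Kb : (Fin (m 0) → ℝ) → Fin (m D) → C₀(Params m D, ℝ))
    (M : ℕ) (x : Fin M → (Fin (m 0) → ℝ)) (c : Fin (m D) → Fin M → ℝ) : Prop :=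
  ‖∑ k, ∑ j, c k j • Kb (x j) k‖ = 1

/-- The objective `∑_{k,j} c_{kj} y_j^k` of the dual problem. -/
def dualObjective (m : ℕ → ℕ) (D : ℕ) (M : ℕ) (Y : Fin (m D) → Fin M → ℝ)
    (c : Fin (m D) → Fin M → ℝ) : ℝ :=
  ∑ k, ∑ j, c k j * Y k j

/-- `c` is a solution of the dual problem. -/
def dualSolves (m : ℕ → ℕ) (D : ℕ)
    (Kb : (Fin (m 0) → ℝ) → Fin (m D) → C₀(Params m D, ℝ))
    (M : ℕ) (x : Fin M → (Fin (m 0) → ℝ)) (Y : Fin (m D) → Fin M → ℝ)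
    (c : Fin (m D) → Fin M → ℝ) : Prop :=
  dualFeasible m D Kb M x c ∧
    ∀ c' : Fin (m D) → Fin M → ℝ, dualFeasible m D Kb M x c' →
      dualObjective m D M Y c' ≤ dualObjective m D M Y c

/-- `ĝ := C* · ∑_{k,j} ĉ_{kj} K_k(x_j,·)`, where `C*` is the optimal dual value
(the value of the dual objective at the dual solution `c`). -/
def ghat (m : ℕ → ℕ) (D : ℕ)
    (Kb : (Fin (m 0) → ℝ) → Fin (m D) → C₀(Params m D, ℝ))
    (M : ℕ) (x : Fin M → (Fin (m 0) → ℝ)) (Y : Fin (m D) → Fin M → ℝ)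
    (c : Fin (m D) → Fin M → ℝ) : C₀(Params m D, ℝ) :=
  dualObjective m D M Y c • ∑ k, ∑ j, c k j • Kb (x j) k

/-- `Θ(g) := {θ ∈ Θ : |g(θ)| = ‖g‖_∞}`. -/
def ThetaSet (m : ℕ → ℕ) (D : ℕ) (g : C₀(Params m D, ℝ)) : Set (Params m D) :=
  {θ | |g θ| = ‖g‖}

/-- The regularization objective `Q(I_X(f) − Y) + λ ‖f‖_{B_N}`. -/
def regObj (σ : ℝ → ℝ) (m : ℕ → ℕ) (D : ℕ) (ρ : Params m D → ℝ)
    (M : ℕ) (x : Fin M → (Fin (m 0) → ℝ)) (Y : Fin (m D) → Fin M → ℝ)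
    (lam : ℝ) (Q : (Fin (m D) → Fin M → ℝ) → ℝ)
    (f : (Fin (m 0) → ℝ) → Fin (m D) → ℝ) : ℝ :=
  Q ((fun k j => f (x j) k) - Y) + lam * BNnorm σ m D ρ f

/-- The solution set `R_{X,Y}` of the regularization problem. -/
def RegSolSet (σ : ℝ → ℝ) (m : ℕ → ℕ) (D : ℕ) (ρ : Params m D → ℝ)
    (M : ℕ) (x : Fin M → (Fin (m 0) → ℝ)) (Y : Fin (m D) → Fin M → ℝ)
    (lam : ℝ) (Q : (Fin (m D) → Fin M → ℝ) → ℝ) :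
    Set ((Fin (m 0) → ℝ) → Fin (m D) → ℝ) :=
  {f | f ∈ BNset σ m D ρ ∧
    ∀ μ : SignedMeasure (Params m D),
      regObj σ m D ρ M x Y lam Q f ≤ regObj σ m D ρ M x Y lam Q (fMu σ m D ρ μ)}

/-- `D_{X,Y} := I_X(R_{X,Y})`. -/
def DXY (σ : ℝ → ℝ) (m : ℕ → ℕ) (D : ℕ) (ρ : Params m D → ℝ)
    (M : ℕ) (x : Fin M → (Fin (m 0) → ℝ)) (Y : Fin (m D) → Fin M → ℝ)
    (lam : ℝ) (Q : (Fin (m D) → Fin M → ℝ) → ℝ) : Set (Fin (m D) → Fin M → ℝ) :=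
  (fun f => fun k j => f (x j) k) '' RegSolSet σ m D ρ M x Y lam Q

/-- In a finite-dimensional space, the convex hull of a compact set is compact. -/
theorem IsCompact.convexHull_of_finiteDimensional {E : Type*} [NormedAddCommGroup E]
    [NormedSpace ℝ E] [FiniteDimensional ℝ E] {s : Set E} (hs : IsCompact s) :
    IsCompact (convexHull ℝ s) := by
  have key : convexHull ℝ s = ⋃ k ∈ Set.Iic (Module.finrank ℝ E + 1),
      (fun p : (Fin k → ℝ) × (Fin k → E) => ∑ i, p.1 i • p.2 i) ''
        (stdSimplex ℝ (Fin k) ×ˢ Set.univ.pi fun _ => s) := by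
    refine Set.Subset.antisymm (fun v hv => ?_) ?_
    · obtain ⟨ι, _, z, w, hz, haff, hw, hw1, rfl⟩ := eq_pos_convex_span_of_mem_convexHull hv
      have hcard : Fintype.card ι ≤ Module.finrank ℝ E + 1 :=
        haff.card_le_finrank_succ.trans
          (Nat.add_le_add_right (Submodule.finrank_le _) 1)
      let e := (Fintype.equivFin ι).symm
      refine Set.mem_biUnion (x := Fintype.card ι) hcard
        ⟨(w ∘ e, z ∘ e), ⟨⟨fun i => (hw _).le, ?_⟩, fun i _ => hz ⟨_, rfl⟩⟩, ?_⟩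
      · exact (e.sum_comp w).trans hw1
      · exact e.sum_comp fun i => w i • z i
    · refine Set.iUnion₂_subset fun k _ => ?_
      rintro _ ⟨⟨w, z⟩, ⟨⟨hw, hw1⟩, hz⟩, rfl⟩
      exact (convex_convexHull ℝ s).sum_mem (fun i _ => hw i) hw1
        fun i _ => subset_convexHull ℝ s (hz i trivial)
  rw [key]
  refine (Set.finite_Iic _).isCompact_biUnion fun k _ => ?_
  exact ((isCompact_stdSimplex ℝ (Fin k)).prod (isCompact_univ_pi fun _ => hs)).image
    (by fun_prop)

section SignedMeasureIntegral

variable {Θ : Type*} [MeasurableSpace Θ]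

theorem tvNorm_nonneg (μ : SignedMeasure Θ) : 0 ≤ tvNorm μ :=
  ENNReal.toReal_nonneg

theorem tvNorm_eq (μ : SignedMeasure Θ) :
    tvNorm μ = μ.toJordanDecomposition.posPart.real Set.univ +
      μ.toJordanDecomposition.negPart.real Set.univ := by
  rw [tvNorm, SignedMeasure.totalVariation, Measure.add_apply,
    ENNReal.toReal_add (measure_ne_top _ _) (measure_ne_top _ _)]
  rfl

theorem tvNorm_sub_le (P N : Measure Θ) [IsFiniteMeasure P] [IsFiniteMeasure N] :
    tvNorm (P.toSignedMeasure - N.toSignedMeasure) ≤ P.real Set.univ + N.real Set.univ := by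
  have h : (P.toSignedMeasure - N.toSignedMeasure).variation ≤ P + N := by
    refine VectorMeasure.variation_le_of_forall_enorm_le fun s hs => ?_
    rw [Measure.toSignedMeasure_sub_apply hs]
    refine (enorm_sub_le).trans ?_
    rw [Real.enorm_of_nonneg measureReal_nonneg, Real.enorm_of_nonneg measureReal_nonneg,
      ofReal_measureReal, ofReal_measureReal, Measure.add_apply]
  rw [tvNorm, SignedMeasure.totalVariation_eq_variation, measureReal_def, measureReal_def,
    ← ENNReal.toReal_add (measure_ne_top _ _) (measure_ne_top _ _)]
  exact ENNReal.toReal_mono (by finiteness) (h Set.univ)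

theorem sInt_sub (P N : Measure Θ) [IsFiniteMeasure P] [IsFiniteMeasure N] {f : Θ → ℝ}
    (hf : ∀ μ : Measure Θ, IsFiniteMeasure μ → Integrable f μ) :
    sInt (P.toSignedMeasure - N.toSignedMeasure) f = ∫ θ, f θ ∂P - ∫ θ, f θ ∂N := by
  set μ := P.toSignedMeasure - N.toSignedMeasure with hμ
  set J := μ.toJordanDecomposition
  have hJ : J.posPart + N = P + J.negPart := by
    rw [← Measure.toSignedMeasure_eq_toSignedMeasure_iff, Measure.toSignedMeasure_add,
      Measure.toSignedMeasure_add]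
    have h : J.posPart.toSignedMeasure - J.negPart.toSignedMeasure = _ :=
      (SignedMeasure.toSignedMeasure_toJordanDecomposition μ).trans hμ
    rwa [sub_eq_sub_iff_add_eq_add] at h
  have h := congrArg (fun ν : Measure Θ => ∫ θ, f θ ∂ν) hJ
  simp only [integral_add_measure (hf _ inferInstance) (hf _ inferInstance)] at h
  rw [sInt]
  linarith

end SignedMeasureIntegral

section MinimalNormInterpolation

open scoped Pointwise

variable {Θ ι : Type*} [TopologicalSpace Θ]

/-- The convex hull of `0`, the values `(K i θ)ᵢ`, and their negatives. -/
def symmHull (K : ι → C₀(Θ, ℝ)) : Set (ι → ℝ) :=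
  convexHull ℝ (insert 0 (Set.range fun θ i => K i θ) ∪
    -insert 0 (Set.range fun θ i => K i θ))

variable (K : ι → C₀(Θ, ℝ))

theorem convex_symmHull : Convex ℝ (symmHull K) :=
  convex_convexHull ℝ _

theorem mem_symmHull (θ : Θ) : (fun i => K i θ) ∈ symmHull K :=
  subset_convexHull ℝ _ (Or.inl (Or.inr ⟨θ, rfl⟩))

theorem zero_mem_symmHull : 0 ∈ symmHull K :=
  subset_convexHull ℝ _ (Or.inl (Or.inl rfl))

theorem neg_mem_symmHull {v : ι → ℝ} (hv : v ∈ symmHull K) : -v ∈ symmHull K := by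
  rwa [symmHull, ← Set.mem_neg, ← convexHull_neg, Set.union_neg, neg_neg, Set.union_comm]

theorem integrable_zeroAtInfty [MeasurableSpace Θ] [OpensMeasurableSpace Θ]
    (f : C₀(Θ, ℝ)) (μ : Measure Θ) [IsFiniteMeasure μ] :
    Integrable f μ :=
  f.toBCF.integrable μ

theorem exists_measures_of_mem_symmHull [MeasurableSpace Θ] [OpensMeasurableSpace Θ]
    {v : ι → ℝ} (hv : v ∈ symmHull K) :
    ∃ P N : Measure Θ, IsFiniteMeasure P ∧ IsFiniteMeasure N ∧
      P.real Set.univ + N.real Set.univ ≤ 1 ∧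
      ∀ i, v i = ∫ θ, K i θ ∂P - ∫ θ, K i θ ∂N := by
  have hconv : Convex ℝ {v : ι → ℝ | ∃ P N : Measure Θ, IsFiniteMeasure P ∧ IsFiniteMeasure N ∧
      P.real Set.univ + N.real Set.univ ≤ 1 ∧
      ∀ i, v i = ∫ θ, K i θ ∂P - ∫ θ, K i θ ∂N} := by
    rintro u ⟨P, N, _, _, h1, hu⟩ v ⟨P', N', _, _, h2, hv⟩ a b ha hb hab
    lift a to NNReal using ha
    lift b to NNReal using hb
    have hint : ∀ i (μ : Measure Θ) [IsFiniteMeasure μ], Integrable (K i) μ :=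
      fun i μ _ => integrable_zeroAtInfty (K i) μ
    refine ⟨a • P + b • P', a • N + b • N', inferInstance, inferInstance, ?_, fun i => ?_⟩
    · rw [measureReal_add_apply, measureReal_add_apply]
      simp only [measureReal_nnreal_smul_apply]
      nlinarith [a.2, b.2]
    · rw [integral_add_measure (hint i (a • P)) (hint i (b • P')),
        integral_add_measure (hint i (a • N)) (hint i (b • N'))]
      simp only [integral_smul_nnreal_measure, NNReal.smul_def, Pi.add_apply, Pi.smul_apply,
        smul_eq_mul, hu i, hv i]
      ring
  refine convexHull_min ?_ hconv hv
  rintro u ((rfl | ⟨θ, rfl⟩) | hu)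
  · exact ⟨0, 0, inferInstance, inferInstance, by simp, by simp⟩
  · refine ⟨Measure.dirac θ, 0, inferInstance, inferInstance, by simp, fun i => ?_⟩
    simp [integral_dirac' (K i) θ (K i).continuous.stronglyMeasurable]
  · rcases hu with hu | ⟨θ, hu⟩
    · exact ⟨0, 0, inferInstance, inferInstance, by simp, by simp [neg_eq_zero.1 hu]⟩
    · refine ⟨0, Measure.dirac θ, inferInstance, inferInstance, by simp, fun i => ?_⟩
      simp [integral_dirac' (K i) θ (K i).continuous.stronglyMeasurable,
        neg_eq_iff_eq_neg.1 hu.symm]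

variable [Fintype ι]

theorem isCompact_symmHull : IsCompact (symmHull K) := by
  have h : IsCompact (insert 0 (Set.range fun θ i => K i θ)) := by
    refine Tendsto.isCompact_insert_range_of_cocompact ?_ (by fun_prop)
    exact tendsto_pi_nhds.2 fun i => zero_at_infty (K i)
  exact (h.union h.neg).convexHull_of_finiteDimensional

theorem exists_mem_smul_symmHull (hK : LinearIndependent ℝ K) (y : ι → ℝ) :
    ∃ t : ℝ, 0 ≤ t ∧ y ∈ t • symmHull K := by
  have hspan : Submodule.span ℝ (Set.range fun θ i => K i θ) = ⊤ := by
    by_contra hne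
    obtain ⟨φ, hφ, hker⟩ := Submodule.exists_le_ker_of_lt_top _ (lt_top_iff_ne_top.2 hne)
    classical
    have hval : ∀ v : ι → ℝ, φ v = ∑ i, v i * φ (Pi.single i 1) := fun v => by
      conv_lhs => rw [pi_eq_sum_univ' v]
      simp [map_sum]
    have hzero : ∑ i, φ (Pi.single i 1) • K i = 0 := by
      ext θ
      have h : φ (fun i => K i θ) = 0 := hker (Submodule.subset_span ⟨θ, rfl⟩)
      rw [hval] at h
      let ev : C₀(Θ, ℝ) →+ ℝ := ⟨⟨fun f => f θ, rfl⟩, fun _ _ => rfl⟩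
      change ev (∑ i, φ (Pi.single i 1) • K i) = 0
      rw [map_sum, ← h]
      exact Finset.sum_congr rfl fun i _ => mul_comm _ _
    have h := Fintype.linearIndependent_iff.1 hK _ hzero
    exact hφ (LinearMap.ext fun v => by simp [hval v, h])
  have hy : y ∈ Submodule.span ℝ (Set.range fun θ i => K i θ) := hspan ▸ Submodule.mem_top
  induction hy using Submodule.span_induction with
  | mem v hv =>
    obtain ⟨θ, rfl⟩ := hv
    exact ⟨1, zero_le_one, by simpa using mem_symmHull K θ⟩
  | zero => exact ⟨0, le_rfl, 0, zero_mem_symmHull K, smul_zero _⟩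
  | add u v _ _ hu hv =>
    obtain ⟨a, ha, hu⟩ := hu
    obtain ⟨b, hb, hv⟩ := hv
    exact ⟨a + b, add_nonneg ha hb, (convex_symmHull K).add_smul ha hb ▸ Set.add_mem_add hu hv⟩
  | smul c v _ hv =>
    obtain ⟨t, ht, v, hv, rfl⟩ := hv
    refine ⟨|c| * t, by positivity, ?_⟩
    rcases abs_cases c with ⟨h, _⟩ | ⟨h, _⟩
    · exact ⟨v, hv, by simp [h, mul_smul]⟩
    · exact ⟨-v, neg_mem_symmHull K hv, by simp [h, mul_smul]⟩

theorem exists_min_mem_smul_symmHull (hK : LinearIndependent ℝ K) (y : ι → ℝ) :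
    ∃ t : ℝ, 0 ≤ t ∧ y ∈ t • symmHull K ∧ ∀ r : ℝ, 0 ≤ r → y ∈ r • symmHull K → t ≤ r := by
  obtain ⟨R, hR, c, hc, hRc⟩ := exists_mem_smul_symmHull K hK y
  have hcomp : IsCompact ((Set.Icc 0 R ×ˢ symmHull K) ∩ {p : ℝ × (ι → ℝ) | p.1 • p.2 = y}) :=
    (isCompact_Icc.prod (isCompact_symmHull K)).inter_right
      (isClosed_eq (by fun_prop) continuous_const)
  obtain ⟨⟨t, v⟩, ⟨⟨ht, hv⟩, hy⟩, hmin⟩ := hcomp.exists_isMinOn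
    ⟨(R, c), ⟨⟨⟨hR, le_rfl⟩, hc⟩, hRc⟩⟩ continuous_fst.continuousOn
  refine ⟨t, ht.1, ⟨v, hv, hy⟩, ?_⟩
  rintro r hr ⟨u, hu, hru⟩
  rcases le_total r R with h | h
  · exact hmin (show (r, u) ∈ _ from ⟨⟨⟨hr, h⟩, hu⟩, hru⟩)
  · exact ht.2.trans h

variable [MeasurableSpace Θ] [OpensMeasurableSpace Θ]

theorem integral_mem_smul_symmHull (μ : Measure Θ) [IsFiniteMeasure μ] :
    (fun i => ∫ θ, K i θ ∂μ) ∈ μ.real Set.univ • symmHull K := by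
  have hint : ∀ i, Integrable (K i) μ := fun i => integrable_zeroAtInfty (K i) μ
  rcases eq_or_ne μ 0 with rfl | hμ
  · exact ⟨0, zero_mem_symmHull K, by ext; simp⟩
  have : NeZero μ := ⟨hμ⟩
  refine ⟨⨍ θ, (fun i => K i θ) ∂μ, (convex_symmHull K).average_mem (isCompact_symmHull K).isClosed
    (ae_of_all _ (mem_symmHull K)) (Integrable.of_eval hint), ?_⟩
  simp only [measure_smul_average]
  ext i
  exact eval_integral hint i

theorem sInt_mem_smul_symmHull (μ : SignedMeasure Θ) :
    (fun i => sInt μ (K i)) ∈ tvNorm μ • symmHull K := by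
  rw [tvNorm_eq, (convex_symmHull K).add_smul measureReal_nonneg measureReal_nonneg]
  refine ⟨_, integral_mem_smul_symmHull K _,
    -fun i => ∫ θ, K i θ ∂μ.toJordanDecomposition.negPart, ?_, ?_⟩
  · obtain ⟨v, hv, h⟩ := integral_mem_smul_symmHull K μ.toJordanDecomposition.negPart
    exact ⟨-v, neg_mem_symmHull K hv, by simp only [smul_neg]; exact congrArg _ h⟩
  · ext i
    simp [sInt, sub_eq_add_neg]

/-- Given linearly independent functions in `C₀(Θ)`, there is a signed measure of minimal
total variation with prescribed integrals against them. -/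
theorem exists_tvNorm_min (hK : LinearIndependent ℝ K) (y : ι → ℝ) :
    ∃ μ : SignedMeasure Θ, (∀ i, sInt μ (K i) = y i) ∧
      ∀ ν : SignedMeasure Θ, (∀ i, sInt ν (K i) = y i) → tvNorm μ ≤ tvNorm ν := by
  obtain ⟨t, ht, ⟨v, hv, hy⟩, hmin⟩ := exists_min_mem_smul_symmHull K hK y
  obtain ⟨P, N, _, _, hPN, hvPN⟩ := exists_measures_of_mem_symmHull K hv
  lift t to NNReal using ht
  refine ⟨(t • P).toSignedMeasure - (t • N).toSignedMeasure, fun i => ?_, fun ν hν => ?_⟩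
  · rw [sInt_sub _ _ fun μ _ => integrable_zeroAtInfty (K i) μ, ← hy]
    simp only [integral_smul_nnreal_measure, NNReal.smul_def, Pi.smul_apply, smul_eq_mul, hvPN i]
    ring
  · refine (tvNorm_sub_le _ _).trans ?_
    have h := sInt_mem_smul_symmHull K ν
    rw [funext hν] at h
    refine le_trans ?_ (hmin _ (tvNorm_nonneg ν) h)
    simp only [measureReal_nnreal_smul_apply]
    nlinarith [t.2]

end MinimalNormInterpolation

/-- If the kernel sections `K_k(x_j,·)` are linearly independent in
`C₀(Θ)`, then the MNI problem
`inf {‖f_μ‖_{B_N} : f_μ ∈ B_N, f_μ(x_j) = y_j, j = 1,…,m}` has at least one solution. -/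
theorem statement_12
    (σ : ℝ → ℝ) (hσ : Continuous σ) (m : ℕ → ℕ) (D : ℕ) (hD : 0 < D)
    (ρ : Params m D → ℝ) (hρc : Continuous ρ) (hρpos : ∀ θ, 0 < ρ θ)
    (Kb : (Fin (m 0) → ℝ) → Fin (m D) → C₀(Params m D, ℝ))
    (hKb : ∀ x k θ, Kb x k θ = NNet σ m D θ x k * ρ θ)
    (M : ℕ) (x : Fin M → (Fin (m 0) → ℝ)) (hx : Function.Injective x)
    (Y : Fin (m D) → Fin M → ℝ)
    (hLI : LinearIndependent ℝ (fun p : Fin (m D) × Fin M => Kb (x p.2) p.1)) :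
    (MNISolSet σ m D ρ M x Y).Nonempty := by
  have hfMu : ∀ (μ : SignedMeasure (Params m D)) j k,
      fMu σ m D ρ μ (x j) k = sInt μ (Kb (x j) k) := fun μ j k => by
    rw [funext (hKb (x j) k), fMu]
  obtain ⟨μ, hμ, hmin⟩ := exists_tvNorm_min _ hLI fun p => Y p.1 p.2
  refine ⟨fMu σ m D ρ μ, ⟨μ, rfl⟩, fun j k => (hfMu μ j k).trans (hμ (k, j)), fun ν hν => ?_⟩
  have hle : BNnorm σ m D ρ (fMu σ m D ρ μ) ≤ tvNorm μ := by
    refine csInf_le ⟨0, ?_⟩ ⟨μ, rfl, rfl⟩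
    rintro _ ⟨ν', _, rfl⟩
    exact tvNorm_nonneg ν'
  refine hle.trans (le_csInf ⟨tvNorm ν, ν, rfl, rfl⟩ ?_)
  rintro _ ⟨ν', hν', rfl⟩
  refine hmin ν' fun p => ?_
  rw [← hfMu, hν']
  exact hν p.2 p.1

end
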